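/- arXiv:0705.4423 — 2 statements merged into one kernel-verified Lean document; each statement's English description precedes it below -/
import Mathlib

section
/- Let m ≥ 2 and n ≥ 1 be integers and set N = n + 2m − 1. Let ε_m = +1 if m ≡ 0 or 1 (mod 4) and ε_m = −1 if m ≡ 2 or 3 (mod 4). Let b_1, …, b_m be nonzero complex numbers satisfying b_i^{2N} = 1 for all i and ∏_{i=1}^m b_i^N = ε_m. Then Σ_{(σ,ε)∈W(D_m)} sgn(σ) ∏_{i=1}^m b_i^{ε_i (N − 2(σ(i) − 1))} = Σ_{(σ,ε)∈W(D_m)} sgn(σ) ∏_{i=1}^m b_i^{2 ε_i (m − σ(i))}. (With a_i = b_i², this states that the Weyl numerator of the spinor character Q^m_{n+1} at g = diag(a_1, a_1^{−1}, …, a_m, a_m^{−1}) equals the Weyl denominator, i.e. Q^m_{n+1}(g) = 1, for the indicated choice of square roots.) -/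
/-- The `D_m`-alternating sum `Σ_{(σ,ε)∈W(D_m)} sgn(σ) ∏ i, b i ^ (ε i * c (σ i))`,
where `W(D_m)` consists of pairs of a permutation `σ` of `{1,…,m}` and a sign vector
`ε ∈ {±1}^m` with `∏ i, ε i = 1`. -/
noncomputable def DSum (m : ℕ) (b : Fin m → ℂ) (c : Fin m → ℤ) : ℂ :=
  ∑ σ : Equiv.Perm (Fin m),
    ∑ ε ∈ Finset.univ.filter (fun ε : Fin m → ℤˣ => ∏ i, ε i = 1),
      ((Equiv.Perm.sign σ : ℤ) : ℂ) * ∏ i, b i ^ ((ε i : ℤ) * c (σ i))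

/-- The sign `ε_m`: `+1` if `m ≡ 0, 1 (mod 4)` and `−1` if `m ≡ 2, 3 (mod 4)`. -/
noncomputable def epsm (m : ℕ) : ℂ := if m % 4 = 0 ∨ m % 4 = 1 then 1 else -1

theorem prod_range_eq_epsm (m : ℕ) : ∏ j ∈ Finset.range m, (-1 : ℂ) ^ j = epsm m := by
  have h4 : ∀ k : ℕ, ∏ j ∈ Finset.range (4 * k), (-1 : ℂ) ^ j = 1 := by
    intro k
    induction k with
    | zero => simp
    | succ k ih =>
      rw [show 4 * (k + 1) = 4 * k + 1 + 1 + 1 + 1 by ring]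
      simp only [Finset.prod_range_succ, ih, pow_add, pow_mul]
      norm_num
  obtain ⟨k, r, hr, rfl⟩ : ∃ k r, r < 4 ∧ m = 4 * k + r :=
    ⟨m / 4, m % 4, Nat.mod_lt _ (by norm_num), by omega⟩
  unfold epsm
  interval_cases r
  · simp [h4]
  · simp only [Finset.prod_range_succ, h4, pow_mul]
    norm_num [Nat.add_mod]
  · simp only [Finset.prod_range_succ, h4, pow_mul, pow_add]
    norm_num [Nat.add_mod]
  · rw [show 4 * k + 3 = 4 * k + 1 + 1 + 1 by ring]
    simp only [Finset.prod_range_succ, h4, pow_mul, pow_add]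
    norm_num [Nat.add_mod]

theorem sign_rev_eq_epsm (m : ℕ) :
    ((Equiv.Perm.sign (Fin.revPerm : Equiv.Perm (Fin m)) : ℤ) : ℂ) = epsm m := by
  have h : Equiv.Perm.sign (Fin.revPerm : Equiv.Perm (Fin m)) = ∏ j : Fin m, (-1 : ℤˣ) ^ (j : ℕ) := by
    rw [Equiv.Perm.sign_eq_prod_prod_Iio]
    refine Finset.prod_congr rfl fun j _ => ?_
    rw [Finset.prod_congr rfl (g := fun _ => (-1 : ℤˣ))]
    · simp
    · intro i hi
      have := Finset.mem_Iio.mp hi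
      simp [this.le]
  rw [h, ← prod_range_eq_epsm, ← Fin.prod_univ_eq_prod_range (fun j => (-1 : ℂ) ^ j)]
  simp

theorem epsm_mul_self (m : ℕ) : epsm m * epsm m = 1 := by
  unfold epsm; split_ifs <;> norm_num

/-- Changing signs on coordinates with exponent sign reversed; the zero exponent fixes parity. -/
theorem flip_sum (m : ℕ) (hm : 2 ≤ m) (b : Fin m → ℂ) (σ : Equiv.Perm (Fin m)) :
    ∑ ε ∈ Finset.univ.filter (fun ε : Fin m → ℤˣ => ∏ i, ε i = 1),
      ∏ i, b i ^ ((ε i : ℤ) * (-2 * ((σ i : ℕ) : ℤ))) =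
    ∑ ε ∈ Finset.univ.filter (fun ε : Fin m → ℤˣ => ∏ i, ε i = 1),
      ∏ i, b i ^ ((ε i : ℤ) * (2 * ((σ i : ℕ) : ℤ))) := by
  obtain ⟨k, rfl⟩ : ∃ k, m = k + 1 := ⟨m - 1, by omega⟩
  set u : Fin (k + 1) → ℤˣ := fun i => if σ i = 0 then (-1) ^ k else -1 with hu
  have hu1 : ∏ i, u i = 1 := by
    rw [hu, Equiv.prod_comp σ (fun j => if j = 0 then (-1 : ℤˣ) ^ k else -1), Fin.prod_univ_succ]
    simp [Fin.succ_ne_zero, ← mul_pow]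
  refine Finset.sum_equiv (Equiv.mulLeft u) ?_ ?_
  · intro ε
    simp [Finset.prod_mul_distrib, hu1]
  · intro ε _
    refine Finset.prod_congr rfl fun i _ => ?_
    congr 1
    by_cases h : σ i = 0
    · simp [h]
    · simp [hu, h]

/-- with `N = n + 2m − 1`, if `b_i^{2N} = 1` for all `i` and
`∏ i, b_i^N = ε_m`, then
`Σ_{(σ,ε)} sgn(σ) ∏ i, b_i^{ε_i (N − 2(σ(i)−1))} = Σ_{(σ,ε)} sgn(σ) ∏ i, b_i^{2 ε_i (m − σ(i))}`
(1-based `σ(i)`, i.e. 0-based exponents `N − 2·σ(i)` and `2(m − 1 − σ(i))`);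
equivalently `Q^m_{n+1}(g) = 1` for `g = diag(a_1, a_1^{−1}, …)`, `a_i = b_i²`. -/
theorem stmt10 (m n : ℕ) (hm : 2 ≤ m) (hn : 1 ≤ n)
    (b : Fin m → ℂ) (hb : ∀ i, b i ≠ 0)
    (hb2N : ∀ i, b i ^ (2 * (n + 2 * m - 1)) = 1)
    (hprod : ∏ i, b i ^ (n + 2 * m - 1) = epsm m) :
    DSum m b (fun k => ((n : ℤ) + 2 * m - 1) - 2 * (k : ℕ)) =
      DSum m b (fun k => 2 * ((m : ℤ) - 1 - (k : ℕ))) := by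
  set N := n + 2 * m - 1 with hN
  have hNZ : (n : ℤ) + 2 * m - 1 = (N : ℤ) := by omega
  have hL : DSum m b (fun k => ((n : ℤ) + 2 * m - 1) - 2 * (k : ℕ)) =
      epsm m * DSum m b (fun k => 2 * ((k : ℕ) : ℤ)) := by
    unfold DSum
    rw [Finset.mul_sum]
    refine Finset.sum_congr rfl fun σ _ => ?_
    rw [← Finset.mul_sum, ← Finset.mul_sum, ← flip_sum m hm b σ, mul_left_comm]
    congr 1
    rw [Finset.mul_sum]
    refine Finset.sum_congr rfl fun ε _ => ?_
    rw [← hprod, ← Finset.prod_mul_distrib]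
    refine Finset.prod_congr rfl fun i _ => ?_
    have h2 : b i ^ ((ε i : ℤ) * (N : ℤ)) = b i ^ N := by
      rcases Int.units_eq_one_or (ε i) with h | h
      · simp [h]
      · have h3 := hb2N i
        rw [two_mul, pow_add] at h3
        simp [h, inv_eq_of_mul_eq_one_left h3]
    rw [hNZ, ← h2, ← zpow_add₀ (hb i)]
    congr 1
    ring
  have hR : DSum m b (fun k => 2 * ((m : ℤ) - 1 - (k : ℕ))) =
      epsm m * DSum m b (fun k => 2 * ((k : ℕ) : ℤ)) := by
    unfold DSum
    rw [Finset.mul_sum, ← Equiv.sum_comp (Equiv.mulLeft (Fin.revPerm : Equiv.Perm (Fin m)))]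
    refine Finset.sum_congr rfl fun σ _ => ?_
    rw [Finset.mul_sum]
    refine Finset.sum_congr rfl fun ε _ => ?_
    rw [← sign_rev_eq_epsm, ← mul_assoc]
    congr 1
    · simp
    · refine Finset.prod_congr rfl fun i _ => ?_
      congr 2
      have := (σ i).isLt
      simp only [Equiv.coe_mulLeft, Equiv.Perm.mul_apply, Fin.revPerm_apply, Fin.val_rev]
      omega
  rw [hL, hR]
end

section
/- Let m ≥ 2 and n ≥ 1 be integers and set N = n + 2m − 1. Let ε_m = +1 if m ≡ 0 or 1 (mod 4) and ε_m = −1 if m ≡ 2 or 3 (mod 4). Let b_1, …, b_m be nonzero complex numbers satisfying b_i^{2N} = 1 for all i and ∏_{i=1}^m b_i^N = ε_m. Then Σ_{(σ,ε)∈W(D_m)} sgn(σ) ∏_{i=1}^m b_i^{ε_i (N + 2(m − σ(i)))} = ε_m · Σ_{(σ,ε)∈W(D_m)} sgn(σ) ∏_{i=1}^m b_i^{2 ε_i (m − σ(i))}. (With a_i = b_i², this states that the Weyl numerator of the spinor character Q^m_{n+2m−1} at g = diag(a_1, a_1^{−1}, …, a_m, a_m^{−1}) equals ε_m times the Weyl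 denominator, i.e. Q^m_{n+2m−1}(g) = ±1 with the sign ε_m.) -/
/-- with `N = n + 2m − 1`, if `b_i^{2N} = 1` for all `i` and
`∏ i, b_i^N = ε_m`, then
`Σ_{(σ,ε)} sgn(σ) ∏ i, b_i^{ε_i (N + 2(m − σ(i)))} = ε_m · Σ_{(σ,ε)} sgn(σ) ∏ i, b_i^{2 ε_i (m − σ(i))}`
(1-based `σ(i)`, i.e. 0-based exponents `N + 2(m − 1 − σ(i))` and `2(m − 1 − σ(i))`);
equivalently `Q^m_{n+2m−1}(g) = ε_m` for `g = diag(a_1, a_1^{−1}, …)`, `a_i = b_i²`. -/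
theorem stmt11 (m n : ℕ) (hm : 2 ≤ m) (hn : 1 ≤ n)
    (b : Fin m → ℂ) (hb : ∀ i, b i ≠ 0)
    (hb2N : ∀ i, b i ^ (2 * (n + 2 * m - 1)) = 1)
    (hprod : ∏ i, b i ^ (n + 2 * m - 1) = epsm m) :
    DSum m b (fun k => ((n : ℤ) + 2 * m - 1) + 2 * ((m : ℤ) - 1 - (k : ℕ))) =
      epsm m * DSum m b (fun k => 2 * ((m : ℤ) - 1 - (k : ℕ))) := by
  have hN : ((n : ℤ) + 2 * m - 1) = ((n + 2 * m - 1 : ℕ) : ℤ) := by omega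
  rw [hN]
  generalize n + 2 * m - 1 = N at hb2N hprod
  have key : ∀ (i : Fin m) (e : ℤˣ), b i ^ ((e : ℤ) * (N : ℤ)) = b i ^ N := by
    intro i e
    rcases Int.units_eq_one_or e with rfl | rfl
    · simp
    · have h : b i ^ N * b i ^ N = 1 := by rw [← pow_add, ← two_mul]; exact hb2N i
      simp only [Units.val_neg, Units.val_one, neg_mul, one_mul, zpow_neg, zpow_natCast]
      exact inv_eq_of_mul_eq_one_left h
  unfold DSum
  rw [Finset.mul_sum]
  refine Finset.sum_congr rfl fun σ _ => ?_
  rw [Finset.mul_sum]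
  refine Finset.sum_congr rfl fun e _ => ?_
  rw [← hprod, mul_left_comm, ← Finset.prod_mul_distrib]
  congr 1
  refine Finset.prod_congr rfl fun i _ => ?_
  rw [mul_add, zpow_add₀ (hb i), key]
end
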